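/- Let G = (V,E) be a finite simple graph and w = w_1…w_l a word over V. If there exist indices 0 ≤ a, b ≤ l such that the prefix w_{1:a} prefixes MIS(G), the suffix w_{b:l} suffixes MIS(G), and the set of vertices occurring in w_{b:a} is an independent set of G (this set being empty when b > a), then w fixes MIS(G). -/

import Mathlib

variable {V : Type*}

/-- One sequential update of the MIS network at vertex `v`:
the state of `v` becomes `1` iff all its neighbours are in state `0`. -/
def misStep [DecidableEq V] (G : SimpleGraph V) (x : V → Prop) (v : V) : V → Prop :=
  Function.update x v (∀ u, G.Adj u v → ¬ x u)

/-- Sequential updates of the MIS network along the word `w` (first letter updated first). -/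
def misWord [DecidableEq V] (G : SimpleGraph V) (w : List V) (x : V → Prop) : V → Prop :=
  w.foldl (misStep G) x

/-- `S` is an independent set of `G`. -/
def IsIndepSet {W : Type*} (G : SimpleGraph W) (S : Set W) : Prop :=
  ∀ ⦃u⦄, u ∈ S → ∀ ⦃v⦄, v ∈ S → ¬ G.Adj u v

/-- `S` is a maximal independent set of `G`. -/
def IsMaxIndepSet {W : Type*} (G : SimpleGraph W) (S : Set W) : Prop :=
  IsIndepSet G S ∧ ∀ T, IsIndepSet G T → S ⊆ T → T = S

theorem misWord_append [DecidableEq V] (G : SimpleGraph V) (p q : List V) (x : V → Prop) :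
    misWord G (p ++ q) x = misWord G q (misWord G p x) := by
  simp [misWord]

theorem misWord_cons [DecidableEq V] (G : SimpleGraph V) (c : V) (q : List V) (x : V → Prop) :
    misWord G (c :: q) x = misWord G q (misStep G x c) := rfl

theorem misStep_indep [DecidableEq V] (G : SimpleGraph V) (x : V → Prop) (c : V)
    (hx : IsIndepSet G {v | x v}) : IsIndepSet G {v | misStep G x c v} := by
  intro u hu v hv huv
  simp only [Set.mem_setOf_eq, misStep, Function.update_apply] at hu hv
  have h := @hx u
  have hne := huv.ne
  by_cases h1 : u = c
  · subst h1
    rw [if_pos rfl] at hu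
    rw [if_neg hne.symm] at hv
    exact hu v huv.symm hv
  · rw [if_neg h1] at hu
    by_cases h2 : v = c
    · subst h2
      rw [if_pos rfl] at hv
      exact hv u huv hu
    · rw [if_neg h2] at hv
      exact hx hu hv huv

theorem misWord_indep [DecidableEq V] (G : SimpleGraph V) (q : List V) :
    ∀ x : V → Prop, IsIndepSet G {v | x v} → IsIndepSet G {v | misWord G q x v} := by
  induction q with
  | nil => intro x hx; exact hx
  | cons c q ih => intro x hx; exact ih _ (misStep_indep G x c hx)

theorem misWord_of_notMem [DecidableEq V] (G : SimpleGraph V) (q : List V) (v : V) (hv : v ∉ q) :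
    ∀ x : V → Prop, misWord G q x v = x v := by
  induction q with
  | nil => intro x; rfl
  | cons c q ih =>
    intro x
    rw [List.mem_cons, not_or] at hv
    rw [misWord_cons, ih hv.2, misStep, Function.update_of_ne hv.1]

theorem misWord_of_mem [DecidableEq V] (G : SimpleGraph V) (q : List V)
    (hq : IsIndepSet G {v | v ∈ q}) (v : V) (hv : v ∈ q) :
    ∀ x : V → Prop, misWord G q x v = (∀ u, G.Adj u v → ¬ x u) := by
  induction q with
  | nil => simp at hv
  | cons c q ih =>
    intro x
    rw [misWord_cons]
    by_cases h : v ∈ q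
    · rw [ih (fun u hu w hw => hq (List.mem_cons_of_mem _ hu) (List.mem_cons_of_mem _ hw)) h]
      refine forall_congr fun u => forall_congr fun huv => ?_
      have hne : u ≠ c := by
        rintro rfl
        exact hq (List.mem_cons_self) hv huv
      rw [misStep, Function.update_of_ne hne]
    · rw [misWord_of_notMem G q v h]
      have : v = c := by simpa [h] using hv
      subst this
      simp [misStep]

theorem misWord_idem [DecidableEq V] (G : SimpleGraph V) (q : List V)
    (hq : IsIndepSet G {v | v ∈ q}) (x : V → Prop) :
    misWord G q (misWord G q x) = misWord G q x := by
  funext v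
  by_cases h : v ∈ q
  · rw [misWord_of_mem G q hq v h, misWord_of_mem G q hq v h]
    refine forall_congr fun u => forall_congr fun huv => ?_
    rw [misWord_of_notMem G q u (fun hu => hq hu h huv)]
  · rw [misWord_of_notMem G q v h]

/-- If the prefix `w.take a` prefixes `MIS(G)`, the suffix `w.drop b` suffixes
`MIS(G)`, and the set of vertices occurring in the overlap `(w.take a).drop b`
(empty when `b ≥ a`) is an independent set of `G`, then `w` fixes `MIS(G)`. -/
theorem stmt_7 [DecidableEq V] [Fintype V] (G : SimpleGraph V) (w : List V)
    (a b : ℕ) (ha : a ≤ w.length) (hb : b ≤ w.length)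
    (hpre : ∀ x : V → Prop, IsIndepSet G {v | misWord G (w.take a) x v})
    (hsuf : ∀ y : V → Prop, IsIndepSet G {v | y v} →
        IsMaxIndepSet G {v | misWord G (w.drop b) y v})
    (hmid : IsIndepSet G {v | v ∈ (w.take a).drop b}) :
    ∀ x : V → Prop, IsMaxIndepSet G {v | misWord G w x v} := by
  intro x
  rcases le_total a b with hab | hab
  · have h1 : w.take b = w.take a ++ (w.take b).drop a := by
      have := List.take_append_drop a (w.take b)
      rw [List.take_take, min_eq_left hab] at this
      exact this.symm
    rw [← List.take_append_drop b w, misWord_append]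
    apply hsuf
    rw [h1, misWord_append]
    exact misWord_indep G _ _ (hpre x)
  · have h1 : w.take a = w.take b ++ (w.take a).drop b := by
      have := List.take_append_drop b (w.take a)
      rw [List.take_take, min_eq_left hab] at this
      exact this.symm
    have h2 : w.drop b = (w.take a).drop b ++ w.drop a := by
      have h3 := List.take_append_drop a w
      rw [h1, List.append_assoc] at h3
      exact (List.append_cancel_left (h3.trans (List.take_append_drop b w).symm)).symm
    have key : misWord G w x = misWord G (w.drop b) (misWord G (w.take a) x) := by
      rw [h2, misWord_append]
      have : misWord G ((w.take a).drop b) (misWord G (w.take a) x)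
          = misWord G (w.take a) x := by
        have e : misWord G (w.take a) x
            = misWord G ((w.take a).drop b) (misWord G (w.take b) x) := by
          rw [← misWord_append, ← h1]
        rw [e, misWord_idem G _ hmid]
      rw [this, ← misWord_append, List.take_append_drop]
    rw [key]
    exact hsuf _ (hpre x)
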